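/- Let n ≥ 2 be even and let x, y ∈ ℂⁿ satisfy s(x) ≠ 0, s(y) ≠ 0 and s(y−x) ≠ 0. Write x* = −x/s(x) ∈ ℂⁿ for the Kelvin inverse vector, so that ι(x*) = ι(x)⁻¹ in Cl_n(ℂ). Then s(x* − y*) = s(y−x)/(s(x)·s(y)), which is nonzero, and the Cauchy kernel transforms according to G(x* − y*) = G(x)⁻¹ · G(y−x) · G(y)⁻¹, where the inverses are taken in Cl_n(ℂ). -/

import Mathlib

noncomputable section
open MeasureTheory
open scoped BigOperators ENNReal

/-- ℂⁿ with its Euclidean norm. -/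
abbrev Cn (n : ℕ) := EuclideanSpace ℂ (Fin n)
/-- ℝⁿ with its Euclidean norm. -/
abbrev Rn (n : ℕ) := EuclideanSpace ℝ (Fin n)

/-- `s z = z₁² + ⋯ + zₙ²`. -/
def sC (n : ℕ) (z : Cn n) : ℂ := ∑ j, z j ^ 2

/-- The quadratic form `Q z = -(z₁² + ⋯ + zₙ²)` on ℂⁿ. -/
def Qf (n : ℕ) : QuadraticForm ℂ (Cn n) :=
  (QuadraticMap.weightedSumSquares ℂ (fun _ : Fin n => (-1 : ℂ))).comp
    (WithLp.linearEquiv 2 ℂ (Fin n → ℂ)).toLinearMap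

/-- The complex Clifford algebra `Cl_n(ℂ)`. -/
abbrev Cl (n : ℕ) := CliffordAlgebra (Qf n)

/-- The structure map `ι : ℂⁿ → Cl_n(ℂ)`. -/
def ιC (n : ℕ) : Cn n →ₗ[ℂ] Cl n := CliffordAlgebra.ι (Qf n)

/-- The `j`-th standard basis vector of ℂⁿ. -/
def eC (n : ℕ) (j : Fin n) : Cn n := EuclideanSpace.single j 1
/-- The `j`-th standard basis vector of ℝⁿ. -/
def eR (n : ℕ) (j : Fin n) : Rn n := EuclideanSpace.single j 1

/-- The componentwise embedding ℝⁿ → ℂⁿ. -/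
def jmap (n : ℕ) (x : Rn n) : Cn n := (WithLp.equiv 2 (Fin n → ℂ)).symm fun i => (x i : ℂ)

/-- The complex Cauchy kernel `G(z) = s(z)^{-n/2} • ι(z)` (for `n` even). -/
def Gc (n : ℕ) (z : Cn n) : Cl n := ((sC n z) ^ (n / 2))⁻¹ • ιC n z

/-- The Euclidean Cauchy kernel `G(x) = ι(x)/‖x‖ⁿ`, `x ∈ ℝⁿ ∖ {0} ⊆ ℂⁿ`. -/
def Gr (n : ℕ) (x : Rn n) : Cl n := (((‖x‖ ^ n : ℝ) : ℂ))⁻¹ • ιC n (jmap n x)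

/-- The Kelvin inverse vector `x* = -x/s(x)`, satisfying `ι(x*) = ι(x)⁻¹`. -/
def kelvin (n : ℕ) (x : Cn n) : Cn n := (-(sC n x)⁻¹) • x

theorem sC_smul_sub_smul (n : ℕ) (a b : ℂ) (x y : Cn n) :
    sC n (a • x - b • y) = a ^ 2 * sC n x + b ^ 2 * sC n y - 2 * a * b * ∑ j, x j * y j := by
  simp only [sC, Finset.mul_sum, ← Finset.sum_add_distrib, ← Finset.sum_sub_distrib]
  refine Finset.sum_congr rfl fun j _ => ?_
  simp only [PiLp.sub_apply, PiLp.smul_apply, smul_eq_mul]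
  ring

theorem sC_kelvin_sub_kelvin (n : ℕ) {x y : Cn n} (hx : sC n x ≠ 0) (hy : sC n y ≠ 0) :
    sC n (kelvin n x - kelvin n y) = sC n (y - x) / (sC n x * sC n y) := by
  have h := sC_smul_sub_smul n 1 1 y x
  rw [one_smul, one_smul] at h
  simp_rw [mul_comm (y _)] at h
  rw [h, kelvin, kelvin, sC_smul_sub_smul]
  field_simp

theorem ιC_mul_self (n : ℕ) (z : Cn n) : ιC n z * ιC n z = -sC n z • (1 : Cl n) := by
  rw [ιC, CliffordAlgebra.ι_sq_scalar, Algebra.algebraMap_eq_smul_one]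
  congr 1
  simp [Qf, sC, QuadraticMap.weightedSumSquares_apply, pow_two]

theorem ιC_kelvin_mul (n : ℕ) {x : Cn n} (hx : sC n x ≠ 0) :
    ιC n (kelvin n x) * ιC n x = 1 := by
  rw [kelvin, map_smul, smul_mul_assoc, ιC_mul_self, smul_smul, neg_mul_neg,
    inv_mul_cancel₀ hx, one_smul]

theorem ιC_mul_kelvin (n : ℕ) {x : Cn n} (hx : sC n x ≠ 0) :
    ιC n x * ιC n (kelvin n x) = 1 := by
  rw [kelvin, map_smul, mul_smul_comm, ιC_mul_self, smul_smul, neg_mul_neg,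
    inv_mul_cancel₀ hx, one_smul]

theorem ringInverse_smul_ιC (n : ℕ) {c : ℂ} (hc : c ≠ 0) {x : Cn n} (hx : sC n x ≠ 0) :
    Ring.inverse (c • ιC n x) = c⁻¹ • ιC n (kelvin n x) :=
  Ring.inverse_unit ⟨c • ιC n x, c⁻¹ • ιC n (kelvin n x),
    by rw [smul_mul_smul_comm, ιC_mul_kelvin n hx, mul_inv_cancel₀ hc, one_smul],
    by rw [smul_mul_smul_comm, ιC_kelvin_mul n hx, inv_mul_cancel₀ hc, one_smul]⟩

theorem ringInverse_Gc (n : ℕ) {x : Cn n} (hx : sC n x ≠ 0) :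
    Ring.inverse (Gc n x) = sC n x ^ (n / 2) • ιC n (kelvin n x) := by
  rw [Gc, ringInverse_smul_ιC n (inv_ne_zero (pow_ne_zero _ hx)) hx, inv_inv]

theorem ιC_kelvin_mul_sub_mul_kelvin (n : ℕ) {x y : Cn n} (hx : sC n x ≠ 0) (hy : sC n y ≠ 0) :
    ιC n (kelvin n x) * ιC n (y - x) * ιC n (kelvin n y) =
      ιC n (kelvin n x - kelvin n y) := by
  rw [map_sub, map_sub, mul_sub, sub_mul, mul_assoc, ιC_mul_kelvin n hy, ιC_kelvin_mul n hx,
    mul_one, one_mul]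

/-- For `n ≥ 2` even and `x, y ∈ ℂⁿ` with `s(x) ≠ 0`, `s(y) ≠ 0` and
`s(y-x) ≠ 0`, with `x* = -x/s(x)` (so that `ι(x*) = ι(x)⁻¹`):
`s(x* - y*) = s(y-x)/(s(x)·s(y)) ≠ 0`, and the Cauchy kernel transforms as
`G(x* - y*) = G(x)⁻¹ · G(y-x) · G(y)⁻¹`. -/
theorem cauchy_kernel_kelvin_transform (n : ℕ) (hn : 2 ≤ n) (heven : Even n)
    (x y : Cn n) (hx : sC n x ≠ 0) (hy : sC n y ≠ 0) (hyx : sC n (y - x) ≠ 0) :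
    Ring.inverse (ιC n x) = ιC n (kelvin n x) ∧
    sC n (kelvin n x - kelvin n y) = sC n (y - x) / (sC n x * sC n y) ∧
    sC n (kelvin n x - kelvin n y) ≠ 0 ∧
    Gc n (kelvin n x - kelvin n y) =
      Ring.inverse (Gc n x) * Gc n (y - x) * Ring.inverse (Gc n y) := by
  have hs := sC_kelvin_sub_kelvin n hx hy
  refine ⟨?_, hs, hs ▸ div_ne_zero hyx (mul_ne_zero hx hy), ?_⟩
  · simpa using ringInverse_smul_ιC n one_ne_zero hx
  · rw [ringInverse_Gc n hx, ringInverse_Gc n hy, Gc, Gc, smul_mul_smul_comm, smul_mul_smul_comm,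
      ιC_kelvin_mul_sub_mul_kelvin n hx hy, hs]
    congr 1
    rw [div_pow, mul_pow, inv_div, div_eq_mul_inv]
    ring
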